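/- Let n ≥ 3 and let R₀ : ℝ^n → ℝ be a smooth nonnegative function. Suppose there exists a C² function u : ℝ^n → ℝ with u > 0, −c_n Δu = R₀ on all of ℝ^n, and u(x) → 0 as x → ∞. Then there exists a C² function w : ℝ^n → ℝ with 0 < w(x) < 1 for all x, satisfying −c_n Δw + R₀ w = 0 on all of ℝ^n and w(x) → 1 as x → ∞. (Geometrically, g = w^{4/(n−2)} g₀ is then a complete conformal metric with zero scalar curvature.) -/

import Mathlib

open Filter

/-- The Euclidean Laplacian on `ℝ^n`: the sum of the second partial derivatives. -/
noncomputable def lap {n : ℕ} (f : EuclideanSpace ℝ (Fin n) → ℝ)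
    (x : EuclideanSpace ℝ (Fin n)) : ℝ :=
  ∑ i, fderiv ℝ (fun y => fderiv ℝ f y (EuclideanSpace.single i 1)) x (EuclideanSpace.single i 1)

section YamabeHelpers

open MeasureTheory Metric Topology Set

variable {n : ℕ}

local notation "E" => EuclideanSpace ℝ (Fin n)

/-! ### Calculus of the Laplacian -/

/-- The `i`-th partial derivative. -/
noncomputable def pderiv (i : Fin n) (f : E → ℝ) (x : E) : ℝ :=
  fderiv ℝ f x (EuclideanSpace.single i 1)

lemma lap_eq_sum_pderiv (f : E → ℝ) (x : E) : lap f x = ∑ i, pderiv i (pderiv i f) x := rfl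

lemma ContDiff.pderiv {f : E → ℝ} {m k : WithTop ℕ∞} (hf : ContDiff ℝ k f) (h : m + 1 ≤ k)
    (i : Fin n) : ContDiff ℝ m (pderiv i f) :=
  (hf.fderiv_right h).clm_apply contDiff_const

lemma pderiv_add {f g : E → ℝ} {x : E} (hf : DifferentiableAt ℝ f x)
    (hg : DifferentiableAt ℝ g x) (i : Fin n) :
    pderiv i (fun y => f y + g y) x = pderiv i f x + pderiv i g x := by
  simp [pderiv, fderiv_fun_add hf hg]

lemma pderiv_const_mul {f : E → ℝ} {x : E} (hf : DifferentiableAt ℝ f x) (c : ℝ) (i : Fin n) :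
    pderiv i (fun y => c * f y) x = c * pderiv i f x := by
  simp [pderiv, fderiv_const_mul hf]

lemma pderiv_mul {f g : E → ℝ} {x : E} (hf : DifferentiableAt ℝ f x)
    (hg : DifferentiableAt ℝ g x) (i : Fin n) :
    pderiv i (fun y => f y * g y) x = f x * pderiv i g x + g x * pderiv i f x := by
  simp [pderiv, fderiv_fun_mul hf hg]

lemma lap_add {f g : E → ℝ} (hf : ContDiff ℝ 2 f) (hg : ContDiff ℝ 2 g) (x : E) :
    lap (fun y => f y + g y) x = lap f x + lap g x := by
  have d {f : E → ℝ} (hf : ContDiff ℝ 2 f) : Differentiable ℝ f := hf.differentiable (by norm_num)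
  have d' {f : E → ℝ} (hf : ContDiff ℝ 2 f) (i : Fin n) : Differentiable ℝ (pderiv i f) :=
    (hf.pderiv (m := 1) (by norm_num) i).differentiable (by norm_num)
  have h (i : Fin n) : pderiv i (fun y => f y + g y) = fun y => pderiv i f y + pderiv i g y :=
    funext fun y => pderiv_add (d hf y) (d hg y) i
  simp only [lap_eq_sum_pderiv, h, ← Finset.sum_add_distrib]
  exact Finset.sum_congr rfl fun i _ => pderiv_add (d' hf i x) (d' hg i x) i

lemma lap_const_mul {f : E → ℝ} (hf : ContDiff ℝ 2 f) (c : ℝ) (x : E) :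
    lap (fun y => c * f y) x = c * lap f x := by
  have h (i : Fin n) : pderiv i (fun y => c * f y) = fun y => c * pderiv i f y :=
    funext fun y => pderiv_const_mul (hf.differentiable (by norm_num) y) c i
  simp only [lap_eq_sum_pderiv, h, Finset.mul_sum]
  exact Finset.sum_congr rfl fun i _ => pderiv_const_mul
    ((hf.pderiv (m := 1) (by norm_num) i).differentiable (by norm_num) x) c i

lemma lap_const (c : ℝ) (x : E) : lap (fun _ : E => c) x = 0 := by
  simp [lap]

lemma lap_sub {f g : E → ℝ} (hf : ContDiff ℝ 2 f) (hg : ContDiff ℝ 2 g) (x : E) :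
    lap (fun y => f y - g y) x = lap f x - lap g x := by
  have := lap_add hf (contDiff_const.mul hg : ContDiff ℝ 2 fun y => (-1 : ℝ) * g y) x
  rw [lap_const_mul hg] at this
  simpa [sub_eq_add_neg] using this

lemma lap_mul {f g : E → ℝ} (hf : ContDiff ℝ 2 f) (hg : ContDiff ℝ 2 g) (x : E) :
    lap (fun y => f y * g y) x = f x * lap g x
      + 2 * ∑ i, pderiv i (fun y => g y * pderiv i f y) x - g x * lap f x := by
  have d {f : E → ℝ} (hf : ContDiff ℝ 2 f) : Differentiable ℝ f := hf.differentiable (by norm_num)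
  have d' {f : E → ℝ} (hf : ContDiff ℝ 2 f) (i : Fin n) : Differentiable ℝ (pderiv i f) :=
    (hf.pderiv (m := 1) (by norm_num) i).differentiable (by norm_num)
  have h (i : Fin n) : pderiv i (fun y => f y * g y)
      = fun y => f y * pderiv i g y + g y * pderiv i f y :=
    funext fun y => pderiv_mul (d hf y) (d hg y) i
  simp only [lap_eq_sum_pderiv, h, Finset.mul_sum, ← Finset.sum_add_distrib,
    ← Finset.sum_sub_distrib]
  refine Finset.sum_congr rfl fun i _ => ?_
  rw [pderiv_add ((d hf x).fun_mul (d' hg i x)) ((d hg x).fun_mul (d' hf i x)),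
    pderiv_mul (d hf x) (d' hg i x), pderiv_mul (d hg x) (d' hf i x)]
  ring

lemma lap_exp_neg {u : E → ℝ} (hu : ContDiff ℝ 2 u) (x : E) :
    lap (fun y => Real.exp (-u y)) x
      = Real.exp (-u x) * (∑ i, pderiv i u x ^ 2 - lap u x) := by
  have hd : Differentiable ℝ u := hu.differentiable (by norm_num)
  have hE : Differentiable ℝ (fun y => Real.exp (-u y)) := hd.neg.exp
  have h (i : Fin n) : pderiv i (fun y => Real.exp (-u y))
      = fun y => (-1) * (Real.exp (-u y) * pderiv i u y) := by
    funext y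
    have := ((hd y).hasFDerivAt.fun_neg.exp).fderiv
    simp [pderiv, this]
  simp only [lap_eq_sum_pderiv, ← Finset.sum_sub_distrib, Finset.mul_sum]
  refine Finset.sum_congr rfl fun i _ => ?_
  have hp := (hu.pderiv (m := 1) (by norm_num) i).differentiable (by norm_num) x
  rw [h i, pderiv_const_mul ((hE x).fun_mul hp), pderiv_mul (hE x) hp, h i]
  ring

lemma deriv_deriv_nonneg_of_isLocalMin {g : ℝ → ℝ} {t : ℝ} (hg : Continuous g)
    (h : IsLocalMin g t) : 0 ≤ deriv (deriv g) t := by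
  by_contra! hlt
  have hmax := isLocalMax_of_deriv_deriv_neg hlt h.deriv_eq_zero hg.continuousAt
  have hc : g =ᶠ[𝓝 t] fun _ => g t := by
    filter_upwards [h, hmax] with s h1 h2 using le_antisymm h2 h1
  have := hc.deriv.deriv_eq
  simp at this
  linarith

lemma lap_nonneg_of_isLocalMin {f : E → ℝ} (hf : ContDiff ℝ 2 f) {x : E} (h : IsLocalMin f x) :
    0 ≤ lap f x := by
  refine Finset.sum_nonneg fun i _ => ?_
  set v : E := EuclideanSpace.single i 1
  have hl (t : ℝ) : HasDerivAt (fun s : ℝ => x + s • v) v t := by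
    simpa using ((hasDerivAt_id t).smul_const v).const_add x
  have hd : Differentiable ℝ f := hf.differentiable (by norm_num)
  have hp : Differentiable ℝ (pderiv i f) :=
    (hf.pderiv (m := 1) (by norm_num) i).differentiable (by norm_num)
  have h1 : deriv (fun s : ℝ => f (x + s • v)) = fun s => pderiv i f (x + s • v) :=
    funext fun t => ((hd _).hasFDerivAt.comp_hasDerivAt t (hl t)).deriv
  have h2 : deriv (fun s : ℝ => pderiv i f (x + s • v)) 0 = pderiv i (pderiv i f) x := by
    have := ((hp _).hasFDerivAt.comp_hasDerivAt (0 : ℝ) (hl 0)).deriv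
    simpa only [zero_smul, add_zero] using! this
  change 0 ≤ pderiv i (pderiv i f) x
  rw [← h2, ← h1]
  refine deriv_deriv_nonneg_of_isLocalMin (hd.continuous.comp (by fun_prop)) ?_
  have hc : Tendsto (fun s : ℝ => x + s • v) (𝓝 0) (𝓝 x) := by
    have : ContinuousAt (fun s : ℝ => x + s • v) 0 := by fun_prop
    simpa [ContinuousAt] using this
  have := hc.eventually h
  simpa [IsLocalMin, IsMinFilter] using this

/-! ### The regularised radial powers -/

/-- The function `(‖x‖² + a) ^ p`. -/
noncomputable def radPow (a p : ℝ) (x : E) : ℝ := (‖x‖ ^ 2 + a) ^ p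

lemma contDiff_radPow {a : ℝ} (ha : 0 < a) (p : ℝ) {m : WithTop ℕ∞} :
    ContDiff ℝ m (radPow a p : E → ℝ) :=
  ((contDiff_norm_sq ℝ).add contDiff_const).rpow_const_of_ne fun x => by positivity

lemma pderiv_radPow {a : ℝ} (ha : 0 < a) (p : ℝ) (i : Fin n) (x : E) :
    pderiv i (radPow a p) x = 2 * p * (x i * radPow a (p - 1) x) := by
  have h : HasFDerivAt (fun y : E => ‖y‖ ^ 2 + a) (2 • innerSL ℝ x) x :=
    (hasStrictFDerivAt_norm_sq x).hasFDerivAt.add_const a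
  have h2 := (h.rpow_const (p := p) (Or.inl (by positivity))).fderiv
  change fderiv ℝ (fun y : E => (‖y‖ ^ 2 + a) ^ p) x _ = _
  rw [h2]
  simp [radPow, EuclideanSpace.inner_single_right]
  ring

lemma pderiv_coord (i : Fin n) (x : E) : pderiv i (fun y : E => y i) x = 1 := by
  have : fderiv ℝ (fun y : E => y i) x = (EuclideanSpace.proj i : E →L[ℝ] ℝ) :=
    (EuclideanSpace.proj i : E →L[ℝ] ℝ).fderiv
  simp [pderiv, this]

/-- The exponent `(2 - n) / 2` of the Newtonian kernel, as a power of `‖x‖²`. -/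
noncomputable def newtonExp (n : ℕ) : ℝ := (2 - n) / 2

lemma lap_radPow {a : ℝ} (ha : 0 < a) (x : E) :
    lap (radPow a (newtonExp n) : E → ℝ) x
      = - ((n - 2) * n * a) * radPow a (newtonExp n - 2) x := by
  have hpos : 0 < ‖x‖ ^ 2 + a := by positivity
  have h (i : Fin n) : pderiv i (pderiv i (radPow a (newtonExp n))) x
      = 2 * newtonExp n * ((x i) ^ 2 * (2 * (newtonExp n - 1) * radPow a (newtonExp n - 2) x)
        + (‖x‖ ^ 2 + a) * radPow a (newtonExp n - 2) x) := by
    have hc : DifferentiableAt ℝ (fun y : E => y i) x :=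
      (EuclideanSpace.proj i : E →L[ℝ] ℝ).differentiableAt
    have hr : DifferentiableAt ℝ (radPow a (newtonExp n - 1)) x :=
      (contDiff_radPow ha _ (m := 1)).differentiable (by norm_num) x
    rw [show pderiv i (radPow a (newtonExp n)) = _ from funext (pderiv_radPow ha _ i),
      pderiv_const_mul (hc.fun_mul hr), pderiv_mul hc hr, pderiv_coord, pderiv_radPow ha]
    have : radPow a (newtonExp n - 1) x = (‖x‖ ^ 2 + a) * radPow a (newtonExp n - 2) x := by
      rw [radPow, radPow, ← Real.rpow_one_add' hpos.le]
      · congr 1; ring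
      · simp [newtonExp]; intro h; have : (n : ℝ) = 0 := by linarith
        have := n.cast_nonneg (α := ℝ)
        have : n = 0 := by exact_mod_cast ‹(n : ℝ) = 0›
        subst this
        exact i.elim0
    rw [this]
    ring_nf
  rw [lap_eq_sum_pderiv, Finset.sum_congr rfl fun i _ => h i, ← Finset.mul_sum,
    Finset.sum_add_distrib, ← Finset.sum_mul, ← EuclideanSpace.real_norm_sq_eq]
  simp [newtonExp]
  ring

lemma tendsto_radPow_cocompact {p : ℝ} (hp : p < 0) (a : ℝ) :
    Tendsto (radPow a p : E → ℝ) (cocompact E) (𝓝 0) := by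
  have h1 : Tendsto (fun x : E => ‖x‖ ^ 2 + a) (cocompact E) atTop :=
    tendsto_atTop_add_const_right _ _
      ((tendsto_pow_atTop two_ne_zero).comp tendsto_norm_cocompact_atTop)
  have := (tendsto_rpow_neg_atTop (y := -p) (by linarith)).comp h1
  simp only [neg_neg, Function.comp_def] at this
  exact this

lemma newtonExp_neg (hn : 3 ≤ n) : newtonExp n < 0 := by
  have : (3 : ℝ) ≤ n := by exact_mod_cast hn
  unfold newtonExp; linarith

/-- Weak maximum principle on the whole space. -/
lemma nonneg_of_lap_nonpos (hn : 3 ≤ n) {f : E → ℝ} (hf : ContDiff ℝ 2 f)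
    (hlim : Tendsto f (cocompact E) (𝓝 0)) (hlap : ∀ x, f x < 0 → lap f x ≤ 0) (x : E) :
    0 ≤ f x := by
  by_contra! hx
  set b : E → ℝ := radPow 1 (newtonExp n) with hb
  have hn' : (3 : ℝ) ≤ n := by exact_mod_cast hn
  have hbpos (y : E) : 0 < b y := by simp only [hb, radPow]; positivity
  have hbc : ContDiff ℝ 2 b := contDiff_radPow one_pos _
  set ε : ℝ := -f x / (2 * b x)
  have hε : 0 < ε := div_pos (by linarith) (by linarith [hbpos x])
  have hεx : ε * b x = -f x / 2 := by
    have := (hbpos x).ne'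
    simp only [ε]; field_simp
  set ψ : E → ℝ := fun y => f y + ε * b y with hψ
  have hψc : ContDiff ℝ 2 ψ := hf.add (contDiff_const.mul hbc)
  have hψx : ψ x < 0 := by simp only [hψ]; rw [hεx]; linarith
  have hψlim : Tendsto ψ (cocompact E) (𝓝 0) := by
    simpa using hlim.add ((tendsto_radPow_cocompact (newtonExp_neg hn) 1).const_mul ε)
  obtain ⟨z, hz⟩ := hψc.continuous.exists_forall_le' x
    ((hψlim.eventually (lt_mem_nhds hψx)).mono fun y hy => hy.le)
  have hz0 : f z < 0 := by
    have h1 : ψ z < 0 := (hz x).trans_lt hψx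
    have h2 : 0 < ε * b z := mul_pos hε (hbpos z)
    simp only [hψ] at h1
    linarith
  have h1 := lap_nonneg_of_isLocalMin hψc (Eventually.of_forall hz : IsLocalMin ψ z)
  rw [hψ, lap_add hf (contDiff_const.mul hbc), lap_const_mul hbc, hb, lap_radPow one_pos] at h1
  have h2 : 0 < radPow 1 (newtonExp n - 2) z := by simp only [radPow]; positivity
  have h3 : 0 < ε * (((n : ℝ) - 2) * n * 1 * radPow 1 (newtonExp n - 2) z) := by
    have : (0 : ℝ) < n - 2 := by linarith
    positivity
  linarith [hlap z hz0]

/-! ### Convolution with locally integrable kernels -/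

/-- The convolution `x ↦ ∫ K t * q (x - t)`. -/
noncomputable def kconv (K q : E → ℝ) (x : E) : ℝ := ∫ t, K t * q (x - t)

lemma kconv_eq_convolution (K q : E → ℝ) :
    kconv K q = convolution K q (ContinuousLinearMap.mul ℝ ℝ) volume := rfl

lemma contDiff_kconv_right {K q : E → ℝ} {m : ℕ∞} (hK : LocallyIntegrable K)
    (hq : ContDiff ℝ m q) (hqs : HasCompactSupport q) : ContDiff ℝ m (kconv K q) := by
  rw [kconv_eq_convolution]
  exact hqs.contDiff_convolution_right (ContinuousLinearMap.mul ℝ ℝ) hK hq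

lemma contDiff_kconv_left {K q : E → ℝ} {m : ℕ∞} (hK : ContDiff ℝ m K)
    (hKs : HasCompactSupport K) (hq : Continuous q) : ContDiff ℝ m (kconv K q) := by
  rw [kconv_eq_convolution]
  exact hKs.contDiff_convolution_left (ContinuousLinearMap.mul ℝ ℝ) hK hq.locallyIntegrable

lemma HasCompactSupport.comp_sub_left' {q : E → ℝ} (hqs : HasCompactSupport q) (x : E) :
    HasCompactSupport (fun t => q (x - t)) :=
  hqs.comp_homeomorph (Homeomorph.subLeft x)

lemma integrable_kconv {K q : E → ℝ} (hK : LocallyIntegrable K) (hq : Continuous q)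
    (hqs : HasCompactSupport q) (x : E) : Integrable (fun t => K t * q (x - t)) := by
  simpa [mul_comm] using hK.integrable_smul_left_of_hasCompactSupport
    (g := fun t => q (x - t)) (by fun_prop) (hqs.comp_sub_left' x)

lemma HasCompactSupport.pderiv {q : E → ℝ} (hqs : HasCompactSupport q) (i : Fin n) :
    HasCompactSupport (pderiv i q) :=
  (hqs.fderiv (𝕜 := ℝ)).comp_left (g := fun L : E →L[ℝ] ℝ => L (EuclideanSpace.single i 1)) rfl

lemma HasCompactSupport.lap {q : E → ℝ} (hqs : HasCompactSupport q) :
    HasCompactSupport (lap q) := by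
  have (s : Finset (Fin n)) :
      HasCompactSupport fun y => ∑ i ∈ s, _root_.pderiv i (_root_.pderiv i q) y := by
    induction s using Finset.induction_on with
    | empty => simpa using! (HasCompactSupport.zero : HasCompactSupport (0 : E → ℝ))
    | insert i s his ih =>
      simp only [Finset.sum_insert his]
      exact ((hqs.pderiv i).pderiv i).add ih
  exact this Finset.univ

lemma ContDiff.continuous_lap {q : E → ℝ} (hq : ContDiff ℝ 2 q) : Continuous (lap q) :=
  continuous_finsetSum _ fun i _ =>
    ((hq.pderiv (m := 1) (by norm_num) i).pderiv (m := 0) (by norm_num) i).continuous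

lemma pderiv_kconv {K q : E → ℝ} (hK : LocallyIntegrable K) (hq : ContDiff ℝ 1 q)
    (hqs : HasCompactSupport q) (i : Fin n) (x : E) :
    pderiv i (kconv K q) x = kconv K (pderiv i q) x := by
  have h := (hqs.hasFDerivAt_convolution_right (ContinuousLinearMap.mul ℝ ℝ) hK hq x).fderiv
  rw [pderiv, kconv_eq_convolution, h,
    convolution_precompR_apply _ hK (hqs.fderiv (𝕜 := ℝ)) (hq.continuous_fderiv one_ne_zero)]
  rfl

lemma pderiv_comp_sub_left {q : E → ℝ} (hq : Differentiable ℝ q) (x : E) (i : Fin n) (t : E) :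
    pderiv i (fun t => q (x - t)) t = -pderiv i q (x - t) := by
  have h := ((hq (x - t)).hasFDerivAt.comp t ((hasFDerivAt_id t).const_sub x)).fderiv
  change fderiv ℝ (q ∘ HSub.hSub x) t _ = _
  rw [h]
  simp [pderiv]

lemma kconv_pderiv {K q : E → ℝ} (hK : ContDiff ℝ 1 K) (hq : ContDiff ℝ 1 q)
    (hqs : HasCompactSupport q) (i : Fin n) (x : E) :
    kconv K (pderiv i q) x = kconv (pderiv i K) q x := by
  have hq' : ContDiff ℝ 1 (fun t => q (x - t)) := hq.comp (contDiff_const.sub contDiff_id)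
  have hK' : Continuous (pderiv i K) := (hK.pderiv (m := 0) (by norm_num) i).continuous
  have hqc : Continuous (pderiv i q) := (hq.pderiv (m := 0) (by norm_num) i).continuous
  have h := integral_mul_fderiv_eq_neg_fderiv_mul_of_integrable (μ := volume) (f := K)
    (g := fun t => q (x - t)) (v := EuclideanSpace.single i 1)
    (integrable_kconv hK'.locallyIntegrable hq.continuous hqs x)
    (by
      have := (integrable_kconv hK.continuous.locallyIntegrable hqc (hqs.pderiv i) x).neg
      refine this.congr (Eventually.of_forall fun t => ?_)
      have := pderiv_comp_sub_left (hq.differentiable (by norm_num)) x i t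
      rw [pderiv] at this
      simp [this])
    (integrable_kconv hK.continuous.locallyIntegrable hq.continuous hqs x)
    (fun t _ => hK.differentiable (by norm_num) t) (fun t _ => hq'.differentiable (by norm_num) t)
  have h2 (t : E) : K t * fderiv ℝ (fun t => q (x - t)) t (EuclideanSpace.single i 1)
      = -(K t * pderiv i q (x - t)) := by
    have := pderiv_comp_sub_left (hq.differentiable (by norm_num)) x i t
    rw [pderiv] at this
    simp [this]
  simp only [h2, integral_neg, neg_inj] at h
  exact h

lemma kconv_sum_right {K : E → ℝ} (hK : LocallyIntegrable K) {q : Fin n → E → ℝ}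
    (hq : ∀ i, Continuous (q i)) (hqs : ∀ i, HasCompactSupport (q i)) (x : E) :
    kconv K (fun y => ∑ i, q i y) x = ∑ i, kconv K (q i) x := by
  simp only [kconv, Finset.mul_sum]
  exact integral_finsetSum _ fun i _ => integrable_kconv hK (hq i) (hqs i) x

lemma kconv_lap_eq_sum {K q : E → ℝ} (hK : LocallyIntegrable K) (hq : ContDiff ℝ 2 q)
    (hqs : HasCompactSupport q) (x : E) :
    kconv K (lap q) x = ∑ i, kconv K (pderiv i (pderiv i q)) x :=
  kconv_sum_right hK
    (fun i => ((hq.pderiv (m := 1) (by norm_num) i).pderiv (m := 0) (by norm_num) i).continuous)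
    (fun i => (hqs.pderiv i).pderiv i) x

lemma kconv_lap {K q : E → ℝ} (hK : ContDiff ℝ 2 K) (hq : ContDiff ℝ 2 q)
    (hqs : HasCompactSupport q) (x : E) : kconv K (lap q) x = kconv (lap K) q x := by
  rw [kconv_lap_eq_sum hK.continuous.locallyIntegrable hq hqs]
  have h (i : Fin n) : kconv K (pderiv i (pderiv i q)) x
      = kconv (pderiv i (pderiv i K)) q x := by
    rw [kconv_pderiv (hK.of_le (by norm_num)) (hq.pderiv (m := 1) (by norm_num) i) (hqs.pderiv i),
      kconv_pderiv (hK.pderiv (m := 1) (by norm_num) i) (hq.of_le (by norm_num)) hqs]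
  rw [Finset.sum_congr rfl fun i _ => h i]
  simp only [kconv, lap_eq_sum_pderiv, Finset.sum_mul]
  refine (integral_finsetSum _ fun i _ => integrable_kconv ?_ hq.continuous hqs x).symm
  exact ((hK.pderiv (m := 1) (by norm_num) i).pderiv (m := 0) (by norm_num)
    i).continuous.locallyIntegrable

lemma lap_kconv {K q : E → ℝ} (hK : LocallyIntegrable K) (hq : ContDiff ℝ 2 q)
    (hqs : HasCompactSupport q) (x : E) : lap (kconv K q) x = kconv K (lap q) x := by
  rw [kconv_lap_eq_sum hK hq hqs, lap_eq_sum_pderiv]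
  refine Finset.sum_congr rfl fun i _ => ?_
  rw [show pderiv i (kconv K q) = kconv K (pderiv i q) from
    funext (pderiv_kconv hK (hq.of_le (by norm_num)) hqs i),
    pderiv_kconv hK (hq.pderiv (m := 1) (by norm_num) i) (hqs.pderiv i)]

/-! ### The Newtonian kernel -/

lemma measurable_radPow (a p : ℝ) : Measurable (radPow a p : E → ℝ) := by
  unfold radPow; fun_prop

lemma radPow_zero (p : ℝ) (x : E) : radPow 0 p x = ‖x‖ ^ (2 * p) := by
  rw [radPow, add_zero, Real.rpow_mul (norm_nonneg _), Real.rpow_two]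

lemma radPow_nonneg {a : ℝ} (ha : 0 ≤ a) (p : ℝ) (x : E) : 0 ≤ radPow a p x := by
  unfold radPow; positivity

lemma locallyIntegrable_newton (hn : 3 ≤ n) :
    LocallyIntegrable (radPow 0 (newtonExp n) : E → ℝ) := by
  refine locallyIntegrable_of_norm_le_rpow (C := 1) (α := n - 2) (by simp; omega) (by simp)
    (Eventually.of_forall fun x => ?_) (measurable_radPow _ _).aestronglyMeasurable
  rw [Real.norm_of_nonneg (radPow_nonneg le_rfl _ _), radPow_zero, newtonExp, one_mul]
  apply le_of_eq
  congr 1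
  ring

lemma abs_coord_le_norm (x : E) (i : Fin n) : |x i| ≤ ‖x‖ := by
  simpa using PiLp.norm_apply_le x i

lemma locallyIntegrable_coord_mul_radPow (hn : 3 ≤ n) (i : Fin n) :
    LocallyIntegrable (fun x : E => x i * radPow 0 (newtonExp n - 1) x) := by
  refine locallyIntegrable_of_norm_le_rpow (C := 1) (α := n - 1) (by simp; omega) (by simp)
    (Eventually.of_forall fun x => ?_)
    (Measurable.mul (by fun_prop) (measurable_radPow _ _)).aestronglyMeasurable
  rcases eq_or_ne x 0 with rfl | hx
  · simp; positivity
  rw [norm_mul, Real.norm_eq_abs, Real.norm_of_nonneg (radPow_nonneg le_rfl _ _), radPow_zero,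
    one_mul]
  refine (mul_le_mul_of_nonneg_right (abs_coord_le_norm x i) (by positivity)).trans (le_of_eq ?_)
  rw [← Real.rpow_one_add' (norm_nonneg x)]
  · congr 1; unfold newtonExp; ring
  · have : (3 : ℝ) ≤ n := by exact_mod_cast hn
    unfold newtonExp; intro h; linarith

lemma tendsto_kconv_radPow (hn : 3 ≤ n) {p : ℝ} (hp : p ≤ 0) {f q : E → ℝ} (hf : Continuous f)
    (hint : LocallyIntegrable (fun t => f t * radPow 0 p t)) (hq : Continuous q)
    (hqs : HasCompactSupport q) (x : E) :
    Tendsto (fun a : ℝ => kconv (fun t => f t * radPow a p t) q x) (𝓝[>] 0)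
      (𝓝 (kconv (fun t => f t * radPow 0 p t) q x)) := by
  have : Nonempty (Fin n) := ⟨⟨0, by omega⟩⟩
  have : Nontrivial E := inferInstance
  have hne : ∀ᵐ t : E, t ≠ 0 := by
    simp [ae_iff]
  refine tendsto_integral_filter_of_dominated_convergence
    (fun t => ‖f t * radPow 0 p t * q (x - t)‖) (Eventually.of_forall fun a => ?_) ?_
    (integrable_kconv hint hq hqs x).norm ?_
  · exact ((hf.measurable.mul (measurable_radPow a p)).mul
      (by fun_prop : Continuous fun t => q (x - t)).measurable).aestronglyMeasurable
  · filter_upwards [self_mem_nhdsWithin] with a ha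
    filter_upwards [hne] with t ht
    have ha : 0 < a := ha
    have htp : 0 < ‖t‖ := norm_pos_iff.2 ht
    simp only [norm_mul]
    gcongr
    rw [Real.norm_of_nonneg (radPow_nonneg ha.le _ _),
      Real.norm_of_nonneg (radPow_nonneg le_rfl _ _)]
    exact Real.rpow_le_rpow_of_nonpos (by positivity) (by linarith) hp
  · filter_upwards [hne] with t ht
    have htp : 0 < ‖t‖ := norm_pos_iff.2 ht
    have : ContinuousAt (fun a : ℝ => (‖t‖ ^ 2 + a) ^ p) 0 :=
      ContinuousAt.rpow_const (by fun_prop) (Or.inl (by positivity))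
    exact ((this.tendsto.mono_left nhdsWithin_le_nhds).const_mul (f t)).mul_const _

/-- The partial derivatives of the Newtonian kernel. -/
noncomputable def newtonGrad (i : Fin n) (x : E) : ℝ :=
  2 * newtonExp n * x i * radPow 0 (newtonExp n - 1) x

lemma locallyIntegrable_newtonGrad (hn : 3 ≤ n) (i : Fin n) :
    LocallyIntegrable (newtonGrad i : E → ℝ) := by
  have := (locallyIntegrable_coord_mul_radPow hn i).smul (2 * newtonExp n)
  refine this.congr (Eventually.of_forall fun x => ?_)
  simp [newtonGrad]; ring

lemma kconv_newton_pderiv (hn : 3 ≤ n) {q : E → ℝ} (hq : ContDiff ℝ 1 q)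
    (hqs : HasCompactSupport q) (i : Fin n) (x : E) :
    kconv (radPow 0 (newtonExp n)) (pderiv i q) x = kconv (newtonGrad i) q x := by
  have hqc : Continuous (pderiv i q) := (hq.pderiv (m := 0) (by norm_num) i).continuous
  have hneg := newtonExp_neg hn
  have h1 := tendsto_kconv_radPow hn hneg.le (f := fun _ => 1) continuous_const
    (by simpa using locallyIntegrable_newton hn) hqc (hqs.pderiv i) x
  have h2 := tendsto_kconv_radPow hn (p := newtonExp n - 1) (by linarith)
    (f := fun t => 2 * newtonExp n * t i) (by fun_prop)
    (locallyIntegrable_newtonGrad hn i) hq.continuous hqs x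
  simp only [one_mul] at h1
  refine tendsto_nhds_unique_of_eventuallyEq h1 h2 ?_
  filter_upwards [self_mem_nhdsWithin] with a ha
  rw [kconv_pderiv (contDiff_radPow ha _) hq hqs]
  congr 1
  funext t
  rw [pderiv_radPow ha]
  ring

/-- The constant `c` with `-Δ(‖x‖^(2-n)) = c δ₀`. -/
noncomputable def newtonConst (n : ℕ) : ℝ :=
  (n - 2) * n * ∫ x : EuclideanSpace ℝ (Fin n), radPow 1 (newtonExp n - 2) x

lemma integrable_newtonBump : Integrable (radPow 1 (newtonExp n - 2) : E → ℝ) := by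
  have : Integrable (fun x : E => ((1 : ℝ) + ‖x‖ ^ 2) ^ (-((n : ℝ) + 2) / 2)) :=
    integrable_rpow_neg_one_add_norm_sq (by simp)
  refine this.congr (Eventually.of_forall fun x => ?_)
  simp only [radPow, newtonExp]
  rw [add_comm]
  congr 1
  ring

lemma integral_newtonBump_pos : 0 < ∫ x : E, radPow 1 (newtonExp n - 2) x := by
  refine (integral_pos_iff_support_of_nonneg (fun x => radPow_nonneg zero_le_one _ x)
    integrable_newtonBump).2 ?_
  have : Function.support (radPow 1 (newtonExp n - 2) : E → ℝ) = univ := by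
    ext x
    have : 0 < radPow 1 (newtonExp n - 2) x := by unfold radPow; positivity
    simp [this.ne']
  rw [this]
  exact isOpen_univ.measure_pos _ univ_nonempty

lemma newtonConst_pos (hn : 3 ≤ n) : 0 < newtonConst n := by
  have : (3 : ℝ) ≤ n := by exact_mod_cast hn
  exact mul_pos (mul_pos (by linarith) (by linarith)) integral_newtonBump_pos

lemma radPow_scale {c : ℝ} (hc : 0 < c) (x : E) :
    (c ^ 2)⁻¹ * radPow (c ^ 2)⁻¹ (newtonExp n - 2) x
      = c ^ n * radPow 1 (newtonExp n - 2) (c • x) := by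
  have h1 : ‖x‖ ^ 2 + (c ^ 2)⁻¹ = (c ^ 2)⁻¹ * (‖c • x‖ ^ 2 + 1) := by
    rw [norm_smul, Real.norm_of_nonneg hc.le]; field_simp
  have h2 : (c ^ 2)⁻¹ * ((c ^ 2)⁻¹) ^ (newtonExp n - 2) = c ^ n := by
    have : (c ^ 2)⁻¹ = c ^ (-2 : ℝ) := by
      rw [Real.rpow_neg hc.le, Real.rpow_two]
    rw [this, ← Real.rpow_mul hc.le, ← Real.rpow_add hc, ← Real.rpow_natCast]
    congr 1
    unfold newtonExp; ring
  rw [radPow, h1, Real.mul_rpow (by positivity) (by positivity), ← mul_assoc, h2, radPow]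

lemma tendsto_norm_pow_mul_newtonBump :
    Tendsto (fun x : E => ‖x‖ ^ n * radPow 1 (newtonExp n - 2) x) (cocompact E) (𝓝 0) := by
  refine squeeze_zero (fun x => mul_nonneg (by positivity) (radPow_nonneg zero_le_one _ _))
    (fun x => ?_) (tendsto_radPow_cocompact (p := -1) (by norm_num) 1)
  have hp : 0 < ‖x‖ ^ 2 + 1 := by positivity
  have h1 : ‖x‖ ^ n ≤ (‖x‖ ^ 2 + 1) ^ ((n : ℝ) / 2) := by
    calc ‖x‖ ^ n = (‖x‖ ^ 2) ^ ((n : ℝ) / 2) := by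
          rw [← Real.rpow_natCast, ← Real.rpow_two, ← Real.rpow_mul (norm_nonneg _)]
          congr 1; ring
      _ ≤ _ := Real.rpow_le_rpow (by positivity) (by linarith) (by positivity)
  refine (mul_le_mul_of_nonneg_right h1 (radPow_nonneg zero_le_one _ _)).trans (le_of_eq ?_)
  rw [radPow, radPow, ← Real.rpow_add hp]
  congr 1
  unfold newtonExp; ring

lemma kconv_newton_lap (hn : 3 ≤ n) {q : E → ℝ} (hq : ContDiff ℝ 2 q)
    (hqs : HasCompactSupport q) (x : E) :
    kconv (radPow 0 (newtonExp n)) (lap q) x = -newtonConst n * q x := by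
  set m := ∫ x : E, radPow 1 (newtonExp n - 2) x with hm
  have hmpos : 0 < m := integral_newtonBump_pos
  have h1 := tendsto_kconv_radPow hn (newtonExp_neg hn).le (f := fun _ => 1) continuous_const
    (by simpa using locallyIntegrable_newton hn) hq.continuous_lap hqs.lap x
  simp only [one_mul] at h1
  have hinv : Tendsto (fun c : ℝ => (c ^ 2)⁻¹) atTop (𝓝[>] 0) :=
    tendsto_inv_atTop_nhdsGT_zero.comp (tendsto_pow_atTop two_ne_zero)
  have h2 := tendsto_integral_comp_smul_smul_of_integrable (μ := (volume : Measure E))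
    (φ := fun t => m⁻¹ * radPow 1 (newtonExp n - 2) t) (g := fun t => q (x - t))
    (fun t => mul_nonneg (by positivity) (radPow_nonneg zero_le_one _ _))
    (by rw [integral_const_mul, ← hm]; field_simp)
    (by
      rw [finrank_euclideanSpace_fin, cobounded_eq_cocompact]
      have := (tendsto_norm_pow_mul_newtonBump (n := n)).const_mul m⁻¹
      simp only [mul_zero] at this
      refine this.congr fun t => by ring)
    ((by fun_prop : Continuous fun t => q (x - t)).integrable_of_hasCompactSupport
      (hqs.comp_sub_left' x))
    (by fun_prop : Continuous fun t => q (x - t)).continuousAt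
  have h3 := (h2.const_mul (-newtonConst n))
  simp only [sub_zero] at h3
  refine tendsto_nhds_unique_of_eventuallyEq (h1.comp hinv) h3 ?_
  filter_upwards [eventually_gt_atTop 0] with c hc
  have hcp : 0 < (c ^ 2)⁻¹ := by positivity
  rw [Function.comp_apply, kconv_lap (contDiff_radPow hcp _) hq hqs, ← integral_const_mul, kconv]
  congr 1
  funext t
  have hs := radPow_scale hc t
  rw [lap_radPow hcp, finrank_euclideanSpace_fin, newtonConst, ← hm, smul_eq_mul]
  calc _ = -((n - 2) * n) * ((c ^ 2)⁻¹ * radPow (c ^ 2)⁻¹ (newtonExp n - 2) t) * q (x - t) := by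
        ring
    _ = _ := by rw [hs]; field_simp

/-! ### Regularity of Newtonian potentials -/

lemma fderiv_eq_sum_pderiv (f : E → ℝ) (x : E) :
    fderiv ℝ f x = ∑ i, pderiv i f x • (EuclideanSpace.proj i : E →L[ℝ] ℝ) := by
  ext v
  conv_lhs => rw [← (EuclideanSpace.basisFun (Fin n) ℝ).sum_repr v]
  simp [pderiv, mul_comm]

lemma contDiff_two_of_pderiv {f : E → ℝ} (hf : ContDiff ℝ 1 f)
    (h : ∀ i, ContDiff ℝ 1 (pderiv i f)) : ContDiff ℝ 2 f := by
  rw [show (2 : WithTop ℕ∞) = 1 + 1 by norm_num, contDiff_succ_iff_fderiv]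
  refine ⟨hf.differentiable (by norm_num), by simp, ?_⟩
  rw [show fderiv ℝ f = _ from funext (fderiv_eq_sum_pderiv f)]
  exact ContDiff.sum fun i _ => (h i).smul contDiff_const

lemma contDiff_one_of_limit {f : ℕ → E → ℝ} {g : E → ℝ} {g' : Fin n → E → ℝ}
    {C : Fin n → ℝ → ℝ} {δ : ℕ → ℝ} (hf : ∀ k, ContDiff ℝ 1 (f k))
    (hfg : ∀ x, Tendsto (fun k => f k x) atTop (𝓝 (g x))) (hδ : Tendsto δ atTop (𝓝 0))
    (h : ∀ k i R x, ‖x‖ ≤ R → |pderiv i (f k) x - g' i x| ≤ δ k * C i R)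
    (hg' : ∀ i, Continuous (g' i)) : ContDiff ℝ 1 g ∧ ∀ i, pderiv i g = g' i := by
  set L : E → E →L[ℝ] ℝ := fun x => ∑ i, g' i x • (EuclideanSpace.proj i : E →L[ℝ] ℝ) with hL
  have hderiv (x : E) : HasFDerivAt g (L x) x := by
    refine hasFDerivAt_of_tendstoUniformlyOn (l := atTop) (f := f) (f' := fun k => fderiv ℝ (f k))
      (s := ball 0 (‖x‖ + 1)) isOpen_ball ?_
      (fun k y _ => ((hf k).differentiable (by norm_num) y).hasFDerivAt) (fun y _ => hfg y)
      (by simp)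
    have hlim : Tendsto (fun k => ∑ i, δ k * C i (‖x‖ + 1)
        * ‖(EuclideanSpace.proj i : E →L[ℝ] ℝ)‖) atTop (𝓝 0) := by
      have := tendsto_finsetSum (Finset.univ : Finset (Fin n)) fun i _ =>
        (hδ.mul_const (C i (‖x‖ + 1))).mul_const ‖(EuclideanSpace.proj i : E →L[ℝ] ℝ)‖
      simpa using this
    rw [Metric.tendstoUniformlyOn_iff]
    intro ε hε
    filter_upwards [hlim.eventually_lt_const hε] with k hk y hy
    refine lt_of_le_of_lt ?_ hk
    rw [dist_comm, dist_eq_norm, fderiv_eq_sum_pderiv, hL, ← Finset.sum_sub_distrib]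
    refine (norm_sum_le _ _).trans (Finset.sum_le_sum fun i _ => ?_)
    rw [← sub_smul, norm_smul]
    refine mul_le_mul_of_nonneg_right (h k i _ y ?_) (norm_nonneg _)
    simpa using (mem_ball.1 hy).le
  refine ⟨contDiff_one_iff_fderiv.2 ⟨fun x => (hderiv x).differentiableAt, ?_⟩, fun i => ?_⟩
  · rw [show fderiv ℝ g = L from funext fun x => (hderiv x).fderiv]
    fun_prop
  · funext x
    rw [pderiv, (hderiv x).fderiv]
    simp [hL]

lemma abs_kconv_sub_le {K q q' : E → ℝ} (hK : LocallyIntegrable K) (hq : Continuous q)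
    (hq' : Continuous q') {r R ε : ℝ} (hqr : ∀ y, r < ‖y‖ → q y = 0)
    (hqr' : ∀ y, r < ‖y‖ → q' y = 0) (h : ∀ y, |q y - q' y| ≤ ε) {x : E} (hx : ‖x‖ ≤ R) :
    |kconv K q x - kconv K q' x| ≤ ε * ∫ t in closedBall 0 (R + r), |K t| := by
  have hs {q : E → ℝ} (hqr : ∀ y, r < ‖y‖ → q y = 0) : HasCompactSupport q :=
    HasCompactSupport.intro (isCompact_closedBall 0 r) fun y hy => hqr y (by simpa using hy)
  rw [kconv, kconv, ← integral_sub (integrable_kconv hK hq (hs hqr) x)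
    (integrable_kconv hK hq' (hs hqr') x), ← integral_const_mul, ← Real.norm_eq_abs,
    ← integral_indicator measurableSet_closedBall]
  have hint : IntegrableOn (fun t => ε * |K t|) (closedBall 0 (R + r)) :=
    (hK.integrableOn_isCompact (isCompact_closedBall 0 (R + r))).abs.const_mul ε
  refine norm_integral_le_of_norm_le (hint.integrable_indicator measurableSet_closedBall)
    (Eventually.of_forall fun t => ?_)
  rw [← mul_sub, norm_mul, Real.norm_eq_abs, Real.norm_eq_abs]
  by_cases ht : t ∈ closedBall (0 : E) (R + r)
  · rw [indicator_of_mem ht, mul_comm]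
    exact mul_le_mul_of_nonneg_right (h _) (abs_nonneg _)
  · have ht' : R + r < ‖t‖ := by simpa using ht
    have : r < ‖x - t‖ := by
      have := norm_sub_norm_le t x
      rw [norm_sub_rev] at this
      linarith
    simp [indicator_of_notMem ht, hqr _ this, hqr' _ this]

lemma tendsto_kconv {K q : E → ℝ} {q' : ℕ → E → ℝ} (hK : LocallyIntegrable K)
    (hq : Continuous q) (hq' : ∀ k, Continuous (q' k)) {r : ℝ} (hqr : ∀ y, r < ‖y‖ → q y = 0)
    (hqr' : ∀ k y, r < ‖y‖ → q' k y = 0) {δ : ℕ → ℝ} (hδ : Tendsto δ atTop (𝓝 0))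
    (h : ∀ k y, |q' k y - q y| ≤ δ k) (x : E) :
    Tendsto (fun k => kconv K (q' k) x) atTop (𝓝 (kconv K q x)) := by
  rw [tendsto_iff_norm_sub_tendsto_zero]
  have := hδ.mul_const (∫ t in closedBall 0 (‖x‖ + r), |K t|)
  rw [zero_mul] at this
  exact squeeze_zero (fun _ => norm_nonneg _)
    (fun k => abs_kconv_sub_le hK (hq' k) hq (hqr' k) hqr (h k) le_rfl) this

lemma exists_radius_of_hasCompactSupport {q : E → ℝ} (hq : HasCompactSupport q) :
    ∃ r, ∀ y, r < ‖y‖ → q y = 0 := by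
  obtain ⟨r, hr⟩ := hq.isCompact.isBounded.subset_closedBall (0 : E)
  refine ⟨r, fun y hy => ?_⟩
  by_contra hne
  have := hr (subset_tsupport q hne)
  simp at this
  linarith

lemma contDiff_one_kconv_newton (hn : 3 ≤ n) {h : E → ℝ} (hh : Continuous h)
    (hhs : HasCompactSupport h) : ContDiff ℝ 1 (kconv (radPow 0 (newtonExp n)) h) := by
  obtain ⟨r, hr⟩ := exists_radius_of_hasCompactSupport hhs
  choose q hq hqh hqs using fun k : ℕ => hh.exists_contDiff_approx (F := ℝ) 1
    (ε := fun _ => (1 / ((k : ℝ) + 1))) continuous_const fun _ => by positivity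
  have hδ : Tendsto (fun k : ℕ => 1 / ((k : ℝ) + 1)) atTop (𝓝 0) :=
    tendsto_one_div_add_atTop_nhds_zero_nat
  have hqr (k y) (hy : r < ‖y‖) : q k y = 0 := by
    by_contra hne
    exact hqs k hne (hr y hy)
  have hqc (k : ℕ) : HasCompactSupport (q k) := hhs.mono (hqs k)
  have hdist (k y) : |q k y - h y| ≤ 1 / ((k : ℝ) + 1) := (hqh k y).le
  refine (contDiff_one_of_limit (f := fun k => kconv (radPow 0 (newtonExp n)) (q k))
    (g' := fun i => kconv (newtonGrad i) h)
    (C := fun i R => ∫ t in closedBall (0 : E) (R + r), |newtonGrad i t|)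
    (fun k => contDiff_kconv_right (m := 1) (locallyIntegrable_newton hn) (hq k) (hqc k))
    (tendsto_kconv (locallyIntegrable_newton hn) hh (fun k => (hq k).continuous) hr hqr hδ hdist)
    hδ (fun k i R x hx => ?_) (fun i => ?_)).1
  · rw [pderiv_kconv (locallyIntegrable_newton hn) (hq k) (hqc k),
      kconv_newton_pderiv hn (hq k) (hqc k)]
    exact abs_kconv_sub_le (locallyIntegrable_newtonGrad hn i) (hq k).continuous hh (hqr k) hr
      (hdist k) hx
  · rw [kconv_eq_convolution]
    exact hhs.continuous_convolution_right _ (locallyIntegrable_newtonGrad hn i) hh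

lemma contDiff_two_kconv_newton (hn : 3 ≤ n) {h : E → ℝ} (hh : ContDiff ℝ 1 h)
    (hhs : HasCompactSupport h) : ContDiff ℝ 2 (kconv (radPow 0 (newtonExp n)) h) := by
  refine contDiff_two_of_pderiv (contDiff_one_kconv_newton hn hh.continuous hhs) fun i => ?_
  rw [show pderiv i (kconv (radPow 0 (newtonExp n)) h) = kconv (radPow 0 (newtonExp n)) (pderiv i h)
    from funext (pderiv_kconv (locallyIntegrable_newton hn) hh hhs i)]
  exact contDiff_one_kconv_newton hn (hh.pderiv (m := 0) (by norm_num) i).continuous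
    (hhs.pderiv i)

lemma tendsto_kconv_newton_cocompact (hn : 3 ≤ n) {q : E → ℝ} (hq : Continuous q)
    (hqs : HasCompactSupport q) :
    Tendsto (kconv (radPow 0 (newtonExp n)) q) (cocompact E) (𝓝 0) := by
  obtain ⟨r, hr⟩ := exists_radius_of_hasCompactSupport hqs
  have hneg := newtonExp_neg hn
  have hlim : Tendsto (fun x : E => (‖x‖ - r) ^ (2 * newtonExp n) * ∫ t, |q t|)
      (cocompact E) (𝓝 0) := by
    have h1 : Tendsto (fun x : E => ‖x‖ - r) (cocompact E) atTop :=
      tendsto_atTop_add_const_right _ _ tendsto_norm_cocompact_atTop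
    have h2 := (tendsto_rpow_neg_atTop (y := -(2 * newtonExp n)) (by linarith)).comp h1
    simpa [Function.comp_def] using h2.mul_const (∫ t, |q t|)
  refine squeeze_zero_norm' ?_ hlim
  filter_upwards [tendsto_norm_cocompact_atTop.eventually_gt_atTop r] with x hx
  rw [← integral_sub_left_eq_self (fun t => |q t|) volume x, ← integral_const_mul, kconv]
  refine norm_integral_le_of_norm_le ?_ (Eventually.of_forall fun t => ?_)
  · exact (((by fun_prop : Continuous fun t => q (x - t)).integrable_of_hasCompactSupport
      (hqs.comp_sub_left' x)).abs).const_mul _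
  · rw [norm_mul, Real.norm_eq_abs (q _)]
    by_cases ht : r < ‖x - t‖
    · simp [hr _ ht]
    · refine mul_le_mul_of_nonneg_right ?_ (abs_nonneg _)
      have : ‖x‖ - r ≤ ‖t‖ := by
        have := norm_sub_norm_le x t
        linarith
      rw [Real.norm_of_nonneg (radPow_nonneg le_rfl _ _), radPow_zero]
      exact Real.rpow_le_rpow_of_nonpos (by linarith) this (by linarith)

/-- The decaying solution of `-Δ z = q` for `q` of class `C²` with compact support. -/
noncomputable def poisson (q : E → ℝ) (x : E) : ℝ :=
  (newtonConst n)⁻¹ * kconv (radPow 0 (newtonExp n)) q x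

lemma contDiff_poisson (hn : 3 ≤ n) {q : E → ℝ} (hq : ContDiff ℝ 2 q)
    (hqs : HasCompactSupport q) : ContDiff ℝ 2 (poisson q) :=
  contDiff_const.mul (contDiff_kconv_right (m := 2) (locallyIntegrable_newton hn) hq hqs)

lemma lap_poisson (hn : 3 ≤ n) {q : E → ℝ} (hq : ContDiff ℝ 2 q)
    (hqs : HasCompactSupport q) (x : E) : lap (poisson q) x = -q x := by
  have hG := locallyIntegrable_newton hn
  have hc := newtonConst_pos hn
  change lap (fun x => (newtonConst n)⁻¹ * kconv (radPow 0 (newtonExp n)) q x) x = _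
  rw [lap_const_mul (contDiff_kconv_right (m := 2) hG hq hqs), lap_kconv hG hq hqs,
    kconv_newton_lap hn hq hqs]
  field_simp

lemma tendsto_poisson (hn : 3 ≤ n) {q : E → ℝ} (hq : Continuous q)
    (hqs : HasCompactSupport q) : Tendsto (poisson q) (cocompact E) (𝓝 0) := by
  have h := (tendsto_kconv_newton_cocompact hn hq hqs).const_mul (newtonConst n)⁻¹
  rwa [mul_zero] at h

lemma poisson_add (hn : 3 ≤ n) {q q' : E → ℝ} (hq : Continuous q) (hqs : HasCompactSupport q)
    (hq' : Continuous q') (hqs' : HasCompactSupport q') (x : E) :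
    poisson (fun y => q y + q' y) x = poisson q x + poisson q' x := by
  have hG := locallyIntegrable_newton hn
  simp only [poisson, kconv, mul_add]
  rw [integral_add (integrable_kconv hG hq hqs x) (integrable_kconv hG hq' hqs' x), mul_add]

lemma poisson_const_mul (c : ℝ) (q : E → ℝ) (x : E) :
    poisson (fun y => c * q y) x = c * poisson q x := by
  simp only [poisson, kconv, mul_left_comm _ c]
  rw [integral_const_mul, mul_left_comm]

/-! ### Approximation of functions vanishing at infinity -/

lemma exists_contDiff_hasCompactSupport_near {f : E → ℝ} (hf : Continuous f)
    (hlim : Tendsto f (cocompact E) (𝓝 0)) {ε : ℝ} (hε : 0 < ε) :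
    ∃ g : E → ℝ, ContDiff ℝ 2 g ∧ HasCompactSupport g ∧ ∀ x, |g x - f x| ≤ 2 * ε := by
  set f' : E → ℝ := fun x => f x - max (-ε) (min ε (f x)) with hf'
  have hf'c : Continuous f' := by fun_prop
  have hd (x : E) : |f' x - f x| ≤ ε := by
    rw [hf', abs_le]
    constructor
    · have : max (-ε) (min ε (f x)) ≤ ε := max_le (by linarith) (min_le_left _ _)
      linarith
    · have := le_max_left (-ε) (min ε (f x))
      linarith
  have hs : HasCompactSupport f' := by
    have h1 : ∀ᶠ x in cocompact E, |f x| < ε := by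
      simpa using (hlim.abs.eventually_lt_const (u := ε) (by simpa using hε))
    obtain ⟨K, hK, hKs⟩ := mem_cocompact.1 h1
    refine HasCompactSupport.intro hK fun x hx => ?_
    have h2 : |f x| < ε := hKs hx
    have h3 := abs_lt.1 h2
    simp only [hf']
    rw [min_eq_right h3.2.le, max_eq_right h3.1.le, sub_self]
  obtain ⟨g, hg, hgd, hgs⟩ := hf'c.exists_contDiff_approx (F := ℝ) 2 (ε := fun _ => ε)
    continuous_const fun _ => hε
  refine ⟨g, hg, hs.mono hgs, fun x => ?_⟩
  have h1 : |g x - f' x| ≤ ε := (hgd x).le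
  have := abs_sub_le (g x) (f' x) (f x)
  linarith [hd x]

/-! ### The continuity method -/

lemma exists_add_eq_of_lower_bound {X : Type*} [NormedAddCommGroup X] [NormedSpace ℝ X]
    [CompleteSpace X] (T : X →L[ℝ] X) {C : ℝ} (hC : 0 ≤ C)
    (h : ∀ t ∈ Icc (0 : ℝ) 1, ∀ w, ‖w‖ ≤ C * ‖w + t • T w‖) (g : X) : ∃ w, w + T w = g := by
  obtain ⟨N, hN⟩ := exists_nat_gt (C * ‖T‖)
  have hN0 : (0 : ℝ) < N := lt_of_le_of_lt (by positivity) hN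
  have key : ∀ k : ℕ, k ≤ N → IsUnit (1 + ((k : ℝ) / N) • T) := by
    intro k
    induction k with
    | zero => simp
    | succ k ih =>
      intro hk
      obtain ⟨x, hx⟩ := ih (by omega)
      have ht : ((k : ℝ) / N) ∈ Icc (0 : ℝ) 1 := by
        refine ⟨by positivity, (div_le_one hN0).2 ?_⟩
        exact_mod_cast (by omega : k ≤ N)
      have hinv : ‖(↑x⁻¹ : X →L[ℝ] X)‖ ≤ C := by
        refine ContinuousLinearMap.opNorm_le_bound _ hC fun y => ?_
        have h1 := h _ ht ((↑x⁻¹ : X →L[ℝ] X) y)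
        have h2 : (x : X →L[ℝ] X) ((↑x⁻¹ : X →L[ℝ] X) y) = y := by
          rw [← mul_apply_eq_comp, Units.mul_inv, one_apply_eq_self]
        rw [hx] at h2
        simpa using h1.trans_eq (congrArg (fun v => C * ‖v‖) h2)
      have hfac : (1 + (((k + 1 : ℕ) : ℝ) / N) • T)
          = x * (1 - (-(N : ℝ)⁻¹) • ((↑x⁻¹ : X →L[ℝ] X) * T)) := by
        rw [mul_sub, mul_smul_comm, Units.mul_inv_cancel_left, hx, mul_one, neg_smul,
          sub_neg_eq_add,
          add_assoc, ← add_smul]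
        congr 2
        push_cast
        field_simp
      rw [hfac]
      refine x.isUnit.mul (isUnit_one_sub_of_norm_lt_one ?_)
      rw [norm_smul, norm_neg, norm_inv, Real.norm_of_nonneg hN0.le]
      calc (N : ℝ)⁻¹ * ‖(↑x⁻¹ : X →L[ℝ] X) * T‖ ≤ (N : ℝ)⁻¹ * (C * ‖T‖) := by
            gcongr
            exact (norm_mul_le _ _).trans (by gcongr)
        _ < (N : ℝ)⁻¹ * N := by gcongr
        _ = 1 := inv_mul_cancel₀ hN0.ne'
  obtain ⟨x, hx⟩ := key N le_rfl
  rw [div_self hN0.ne', one_smul] at hx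
  refine ⟨(↑x⁻¹ : X →L[ℝ] X) g, ?_⟩
  have h2 : (x : X →L[ℝ] X) ((↑x⁻¹ : X →L[ℝ] X) g) = g := by
    rw [← mul_apply_eq_comp, Units.mul_inv, one_apply_eq_self]
  rw [hx] at h2
  simpa using h2

lemma abs_le_mul_of_lap_bound (hn : 3 ≤ n) {V u z : E → ℝ} (hu : ContDiff ℝ 2 u)
    (hupos : ∀ x, 0 < u x) (hulap : ∀ x, lap u x = -V x) (hulim : Tendsto u (cocompact E) (𝓝 0))
    (hz : ContDiff ℝ 2 z) (hzlim : Tendsto z (cocompact E) (𝓝 0)) {B : ℝ} (hB : 0 ≤ B)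
    (h1 : ∀ x, 0 ≤ z x → -(B * V x) ≤ lap z x) (h2 : ∀ x, z x ≤ 0 → lap z x ≤ B * V x) (x : E) :
    |z x| ≤ B * u x := by
  have hBu : ContDiff ℝ 2 fun y => B * u y := contDiff_const.mul hu
  have hBlim : Tendsto (fun y => B * u y) (cocompact E) (𝓝 0) := by
    simpa using hulim.const_mul B
  have hlapB (y : E) : lap (fun y => B * u y) y = -(B * V y) := by
    rw [lap_const_mul hu, hulap]; ring
  have hBpos (y : E) : 0 ≤ B * u y := mul_nonneg hB (hupos y).le
  rw [abs_le]
  constructor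
  · have := nonneg_of_lap_nonpos hn (f := fun y => B * u y + z y) (hBu.add hz)
      (by simpa using hBlim.add hzlim) (fun y hy => ?_) x
    · linarith
    · rw [lap_add hBu hz, hlapB]
      linarith [h2 y (by linarith [hBpos y])]
  · have := nonneg_of_lap_nonpos hn (f := fun y => B * u y - z y) (hBu.sub hz)
      (by simpa using hBlim.sub hzlim) (fun y hy => ?_) x
    · linarith
    · rw [lap_sub hBu hz, hlapB]
      linarith [h1 y (by linarith [hBpos y])]

lemma ZeroAtInftyContinuousMap.abs_apply_le (f : ZeroAtInftyContinuousMap E ℝ) (x : E) :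
    |f x| ≤ ‖f‖ :=
  f.toBCF.norm_coe_le_norm x

lemma ZeroAtInftyContinuousMap.norm_le_of_forall {f : ZeroAtInftyContinuousMap E ℝ} {C : ℝ}
    (hC : 0 ≤ C) (h : ∀ x, |f x| ≤ C) : ‖f‖ ≤ C := by
  rw [← ZeroAtInftyContinuousMap.norm_toBCF_eq_norm]
  exact (BoundedContinuousFunction.norm_le hC).2 h

/-- The compactly supported functions of class `C²`, as a subspace of `C₀`. -/
noncomputable def smoothCompact (n : ℕ) :
    Submodule ℝ (ZeroAtInftyContinuousMap (EuclideanSpace ℝ (Fin n)) ℝ) where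
  carrier := {f | ContDiff ℝ 2 f ∧ HasCompactSupport f}
  add_mem' hf hg := ⟨hf.1.add hg.1, hf.2.add hg.2⟩
  zero_mem' := ⟨contDiff_const, HasCompactSupport.zero⟩
  smul_mem' c _ hf := ⟨contDiff_const.mul hf.1, hf.2.mul_left (f := fun _ => c)⟩

lemma denseRange_smoothCompact : DenseRange (smoothCompact n).subtype := by
  rw [Metric.denseRange_iff]
  intro f r hr
  obtain ⟨g, hg, hgs, hgf⟩ := exists_contDiff_hasCompactSupport_near f.continuous
    f.zero_at_infty' (ε := r / 4) (by positivity)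
  refine ⟨⟨⟨⟨g, hg.continuous⟩, hgs.is_zero_at_infty⟩, hg, hgs⟩, ?_⟩
  rw [dist_comm, dist_eq_norm]
  refine lt_of_le_of_lt (ZeroAtInftyContinuousMap.norm_le_of_forall (C := 2 * (r / 4))
    (by positivity) hgf) (by linarith)

/-- The operator `h ↦ (-Δ)⁻¹ (V h)`. -/
noncomputable def poissonMul (hn : 3 ≤ n) {V : E → ℝ} (hV : ContDiff ℝ 2 V) :
    smoothCompact n →ₗ[ℝ] ZeroAtInftyContinuousMap E ℝ where
  toFun h := ⟨⟨poisson fun y => V y * h.1 y,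
    (contDiff_poisson hn (hV.mul h.2.1) h.2.2.mul_left).continuous⟩,
    tendsto_poisson hn (hV.mul h.2.1).continuous h.2.2.mul_left⟩
  map_add' h h' := by
    ext x
    change poisson _ x = poisson _ x + poisson _ x
    rw [← poisson_add hn (hV.mul h.2.1).continuous h.2.2.mul_left (hV.mul h'.2.1).continuous
      h'.2.2.mul_left]
    congr 1
    funext y
    exact mul_add _ _ _
  map_smul' c h := by
    ext x
    change poisson _ x = c * poisson _ x
    rw [← poisson_const_mul]
    congr 1
    funext y
    exact mul_left_comm _ _ _

lemma exists_extension_of_bound {X : Type*} [NormedAddCommGroup X] [NormedSpace ℝ X]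
    [CompleteSpace X] {S : Submodule ℝ X} (hS : DenseRange S.subtype) (f : S →ₗ[ℝ] X) {C : ℝ}
    (hf : ∀ s, ‖f s‖ ≤ C * ‖S.subtype s‖) : ∃ T : X →L[ℝ] X, ∀ s : S, T s = f s :=
  ⟨LinearMap.extendOfNorm f S.subtype, LinearMap.extendOfNorm_eq hS ⟨C, hf⟩⟩

lemma exists_approximate_solutions (hn : 3 ≤ n) {V u : E → ℝ} (hV : ContDiff ℝ 2 V)
    (hV0 : ∀ x, 0 ≤ V x) (hu : ContDiff ℝ 2 u) (hupos : ∀ x, 0 < u x)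
    (hulap : ∀ x, lap u x = -V x) (hulim : Tendsto u (cocompact E) (𝓝 0)) :
    ∃ (z : E → ℝ) (h : ℕ → E → ℝ) (δ : ℕ → ℝ), Continuous z ∧ Tendsto z (cocompact E) (𝓝 0) ∧
      (∀ k, ContDiff ℝ 2 (h k)) ∧ (∀ k, HasCompactSupport (h k)) ∧ Tendsto δ atTop (𝓝 0) ∧
      (∀ k x, |h k x - z x| ≤ δ k) ∧
      ∀ k x, |u x - poisson (fun y => V y * h k y) x - z x| ≤ δ k := by
  set U : ZeroAtInftyContinuousMap E ℝ := ⟨⟨u, hu.continuous⟩, hulim⟩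
  have huM (x : E) : u x ≤ ‖U‖ := (le_abs_self _).trans (U.abs_apply_le x)
  set T₀ := poissonMul hn hV
  have hbound (w : smoothCompact n) : ‖T₀ w‖ ≤ ‖U‖ * ‖(smoothCompact n).subtype w‖ := by
    refine ZeroAtInftyContinuousMap.norm_le_of_forall (by positivity) fun x => ?_
    have hVw : ContDiff ℝ 2 fun y => V y * w.1 y := hV.mul w.2.1
    have hws (y : E) := abs_le.1 (w.1.abs_apply_le y)
    have := abs_le_mul_of_lap_bound hn (z := poisson fun y => V y * w.1 y) hu hupos hulap hulim
      (contDiff_poisson hn hVw w.2.2.mul_left) (tendsto_poisson hn hVw.continuous w.2.2.mul_left)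
      (B := ‖w.1‖) (norm_nonneg _) (fun y _ => ?_) (fun y _ => ?_) x
    · refine this.trans ?_
      rw [mul_comm]
      exact mul_le_mul_of_nonneg_right (huM x) (norm_nonneg _)
    · rw [lap_poisson hn hVw w.2.2.mul_left]
      nlinarith [hV0 y, (hws y).2]
    · rw [lap_poisson hn hVw w.2.2.mul_left]
      nlinarith [hV0 y, (hws y).1]
  have hdense := denseRange_smoothCompact (n := n)
  obtain ⟨T, hTeq⟩ := exists_extension_of_bound hdense T₀ hbound
  change ∀ w : smoothCompact n, T w.1 = T₀ w at hTeq
  have hlower (t : ℝ) (ht : t ∈ Icc (0 : ℝ) 1) (w : ZeroAtInftyContinuousMap E ℝ) :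
      ‖w‖ ≤ (1 + ‖U‖) * ‖w + t • T w‖ := by
    refine hdense.induction_on (p := fun w => ‖w‖ ≤ (1 + ‖U‖) * ‖w + t • T w‖) w
      (isClosed_le (by fun_prop) (by fun_prop)) fun w => ?_
    change ‖w.1‖ ≤ (1 + ‖U‖) * ‖w.1 + t • T w.1‖
    rw [hTeq]
    set g := w.1 + t • T₀ w with hg
    have hVw : ContDiff ℝ 2 fun y => V y * w.1 y := hV.mul w.2.1
    have hP := contDiff_poisson hn hVw w.2.2.mul_left
    have hgw (y : E) : g y = w.1 y + t * poisson (fun y => V y * w.1 y) y := rfl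
    have hgs (y : E) := abs_le.1 (g.abs_apply_le y)
    have hlap (y : E) : lap (fun y => t * poisson (fun y => V y * w.1 y) y) y
        = -(t * V y) * (g y - t * poisson (fun y => V y * w.1 y) y) := by
      rw [lap_const_mul hP, lap_poisson hn hVw w.2.2.mul_left, hgw]
      ring
    have htV (y : E) : 0 ≤ t * V y := mul_nonneg ht.1 (hV0 y)
    have hcomp := abs_le_mul_of_lap_bound hn (z := fun y => t * poisson (fun y => V y * w.1 y) y)
      hu hupos hulap hulim (contDiff_const.mul hP)
      (by simpa using
        (tendsto_poisson hn hVw.continuous w.2.2.mul_left).const_mul t)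
      (B := t * ‖g‖) (mul_nonneg ht.1 (norm_nonneg _))
      (fun y hy => by rw [hlap]; nlinarith [htV y, (hgs y).2])
      (fun y hy => by rw [hlap]; nlinarith [htV y, (hgs y).1])
    refine ZeroAtInftyContinuousMap.norm_le_of_forall (by positivity) fun x => ?_
    have h1 : w.1 x = g x - t * poisson (fun y => V y * w.1 y) x := by rw [hgw]; ring
    have h2 : t * ‖g‖ * u x ≤ ‖g‖ * ‖U‖ := by
      have : t * ‖g‖ ≤ ‖g‖ := mul_le_of_le_one_left (norm_nonneg _) ht.2
      exact mul_le_mul this (huM x) (hupos x).le (norm_nonneg _)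
    rw [h1]
    calc _ ≤ |g x| + |t * poisson (fun y => V y * w.1 y) x| := abs_sub _ _
      _ ≤ ‖g‖ + ‖g‖ * ‖U‖ := add_le_add (g.abs_apply_le x) ((hcomp x).trans h2)
      _ = _ := by ring
  obtain ⟨z, hz⟩ := exists_add_eq_of_lower_bound T (by positivity) hlower U
  have happ (k : ℕ) : ∃ w : smoothCompact n, ‖w.1 - z‖ < 1 / ((k : ℝ) + 1) := by
    obtain ⟨w, hw⟩ := (Metric.denseRange_iff.1 hdense) z (1 / ((k : ℝ) + 1)) (by positivity)
    exact ⟨w, by rwa [dist_comm, dist_eq_norm] at hw⟩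
  choose w hw using happ
  have hδ : Tendsto (fun k : ℕ => (1 + ‖T‖) * (1 / ((k : ℝ) + 1))) atTop (𝓝 0) := by
    simpa using (tendsto_one_div_add_atTop_nhds_zero_nat (𝕜 := ℝ)).const_mul (1 + ‖T‖)
  refine ⟨z, fun k => (w k).1, _, z.continuous, z.zero_at_infty', fun k => (w k).2.1,
    fun k => (w k).2.2, hδ, fun k x => ?_, fun k x => ?_⟩
  · have h1 := ((w k).1 - z).abs_apply_le x
    refine h1.trans ((hw k).le.trans (le_mul_of_one_le_left (by positivity) ?_))
    linarith [norm_nonneg T]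
  · have h1 : u x - poisson (fun y => V y * (w k).1 y) x - z x = (T (z - (w k).1)) x := by
      have h2 : z x + (T z) x = u x := DFunLike.congr_fun hz x
      have h3 : (T (w k).1) x = poisson (fun y => V y * (w k).1 y) x := by rw [hTeq]; rfl
      rw [map_sub, ZeroAtInftyContinuousMap.sub_apply, h3, ← h2]
      ring
    rw [h1]
    refine (ZeroAtInftyContinuousMap.abs_apply_le _ x).trans ((T.le_opNorm _).trans ?_)
    rw [norm_sub_rev]
    have := (hw k).le
    have h4 : (0 : ℝ) ≤ 1 / ((k : ℝ) + 1) := by positivity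
    nlinarith [norm_nonneg T]

/-! ### Localized representation and interior regularity -/

lemma pderiv_eq_zero_of_eventuallyEq {f : E → ℝ} {x : E} {c : ℝ} (h : f =ᶠ[𝓝 x] fun _ => c)
    (i : Fin n) : pderiv i f x = 0 := by
  simp [pderiv, h.fderiv_eq]

lemma pderiv_eventuallyEq_zero {f : E → ℝ} {x : E} {c : ℝ} (h : f =ᶠ[𝓝 x] fun _ => c)
    (i : Fin n) : pderiv i f =ᶠ[𝓝 x] fun _ => 0 :=
  h.eventuallyEq_nhds.mono fun _ hy => pderiv_eq_zero_of_eventuallyEq hy i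

lemma kconv_congr_left {K K' q : E → ℝ} {x : E} (h : ∀ t, q (x - t) ≠ 0 → K t = K' t) :
    kconv K q x = kconv K' q x := by
  refine integral_congr_ae (Eventually.of_forall fun t => ?_)
  by_cases ht : q (x - t) = 0
  · simp [ht]
  · simp only [h t ht]

lemma exists_localized_representation (hn : 3 ≤ n) {R : ℝ} (hR : 0 < R) :
    ∃ χ S : E → ℝ, ContDiff ℝ 3 χ ∧ HasCompactSupport χ ∧ ContDiff ℝ 3 S ∧ HasCompactSupport S ∧
      ∀ ζ : E → ℝ, ContDiff ℝ 2 ζ → ∀ x ∈ ball (0 : E) R,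
        -newtonConst n * ζ x = kconv (radPow 0 (newtonExp n)) (fun y => χ y * lap ζ y) x
          + 2 * ∑ i, kconv (pderiv i S) (fun y => pderiv i χ y * ζ y) x
          - kconv S (fun y => lap χ y * ζ y) x := by
  let χ : ContDiffBump (0 : E) := ⟨R + 1, R + 2, by linarith, by linarith⟩
  let b₁ : ContDiffBump (0 : E) := ⟨1 / 2, 1, by norm_num, by norm_num⟩
  let b₂ : ContDiffBump (0 : E) := ⟨2 * R + 3, 2 * R + 4, by linarith, by linarith⟩
  set S : E → ℝ := fun t => b₂ t * (‖t‖ ^ 2 + b₁ t) ^ newtonExp n with hS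
  have hpos (t : E) : 0 < ‖t‖ ^ 2 + b₁ t := by
    rcases eq_or_ne t 0 with rfl | ht
    · have : b₁ (0 : E) = 1 := b₁.one_of_mem_closedBall (by simp; norm_num)
      rw [this]; positivity
    · have := b₁.nonneg (x := t)
      have : 0 < ‖t‖ := norm_pos_iff.2 ht
      positivity
  have hχc : ContDiff ℝ 3 χ := χ.contDiff
  have hSc : ContDiff ℝ 3 S :=
    b₂.contDiff.mul (((contDiff_norm_sq ℝ).add b₁.contDiff).rpow_const_of_ne fun x => (hpos x).ne')
  have hSG (t : E) (h1 : 1 ≤ ‖t‖) (h2 : ‖t‖ ≤ 2 * R + 3) : radPow 0 (newtonExp n) t = S t := by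
    have h3 : b₁ t = 0 := b₁.zero_of_le_dist (by simpa using h1)
    have h4 : b₂ t = 1 := b₂.one_of_mem_closedBall (by simpa using h2)
    simp [hS, h3, h4, radPow]
  have hin (y : E) (hy : ‖y‖ < R + 1) : χ =ᶠ[𝓝 y] fun _ => 1 := by
    filter_upwards [isOpen_ball.mem_nhds (mem_ball_zero_iff.2 hy)] with w hw
    exact χ.one_of_mem_closedBall (ball_subset_closedBall hw)
  have hout (y : E) (hy : R + 2 < ‖y‖) : χ =ᶠ[𝓝 y] fun _ => 0 := by
    filter_upwards [isClosed_closedBall.isOpen_compl.mem_nhds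
      (show y ∈ (closedBall (0 : E) (R + 2))ᶜ by simpa using hy)] with w hw
    refine χ.zero_of_le_dist ?_
    have : R + 2 < ‖w‖ := by simpa using hw
    simpa using this.le
  refine ⟨χ, S, hχc, χ.hasCompactSupport, hSc, b₂.hasCompactSupport.mul_right, fun ζ hζ x hx => ?_⟩
  have hx : ‖x‖ < R := by simpa using hx
  have hG := locallyIntegrable_newton hn
  have hreplace (q : E → ℝ) (hq : ∀ y c, χ =ᶠ[𝓝 y] (fun _ => c) → q y = 0) :
      kconv (radPow 0 (newtonExp n)) q x = kconv S q x := by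
    refine kconv_congr_left fun t ht => ?_
    have h1 : R + 1 ≤ ‖x - t‖ := by
      by_contra! h
      exact ht (hq _ _ (hin _ h))
    have h2 : ‖x - t‖ ≤ R + 2 := by
      by_contra! h
      exact ht (hq _ _ (hout _ h))
    refine hSG t ?_ ?_
    · linarith [norm_sub_le x t]
    · have := norm_sub_norm_le t x
      rw [norm_sub_rev] at this
      linarith
  set q : Fin n → E → ℝ := fun i y => ζ y * pderiv i χ y with hq
  have hqc (i : Fin n) : ContDiff ℝ 1 (q i) :=
    (hζ.of_le (by norm_num)).mul (hχc.pderiv (by norm_num) i)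
  have hqs (i : Fin n) : HasCompactSupport (q i) := (χ.hasCompactSupport.pderiv i).mul_left
  have hqc' (i : Fin n) : Continuous (pderiv i (q i)) :=
    ((hqc i).pderiv (m := 0) (by norm_num) i).continuous
  have hχ2 : ContDiff ℝ 2 χ := χ.contDiff
  have hlapsplit : lap (fun y => χ y * ζ y) = fun y => (χ y * lap ζ y
      + 2 * ∑ i, pderiv i (q i) y) - lap χ y * ζ y := by
    funext y
    rw [lap_mul hχ2 hζ, mul_comm (ζ y)]
  have hmain := kconv_newton_lap hn (hχ2.mul hζ) χ.hasCompactSupport.mul_right x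
  have hχx : χ x = 1 := χ.one_of_mem_closedBall (by
    have : ‖x‖ ≤ R + 1 := by linarith
    simpa using this)
  rw [hχx, one_mul] at hmain
  rw [← hmain, hlapsplit]
  have hi1 := integrable_kconv (q := fun y => χ y * lap ζ y) hG
    (hχ2.continuous.mul hζ.continuous_lap)
    χ.hasCompactSupport.mul_right x
  have hi2 (i : Fin n) := integrable_kconv hG (hqc' i) ((hqs i).pderiv i) x
  have hi3 := integrable_kconv (q := fun y => lap χ y * ζ y) hG
    (hχ2.continuous_lap.mul hζ.continuous)
    χ.hasCompactSupport.lap.mul_right x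
  have hsplit : kconv (radPow 0 (newtonExp n)) (fun y => (χ y * lap ζ y
      + 2 * ∑ i, pderiv i (q i) y) - lap χ y * ζ y) x
      = kconv (radPow 0 (newtonExp n)) (fun y => χ y * lap ζ y) x
        + 2 * ∑ i, kconv (radPow 0 (newtonExp n)) (pderiv i (q i)) x
        - kconv (radPow 0 (newtonExp n)) (fun y => lap χ y * ζ y) x := by
    simp only [kconv]
    rw [← integral_finsetSum _ fun i _ => hi2 i, ← integral_const_mul, ← integral_add hi1
      ((integrable_finsetSum _ fun i _ => hi2 i).const_mul 2), ← integral_sub _ hi3]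
    · congr 1
      funext t
      rw [← Finset.mul_sum]
      ring
    · exact hi1.add ((integrable_finsetSum _ fun i _ => hi2 i).const_mul 2)
  rw [hsplit]
  congr 1
  · congr 2
    refine Finset.sum_congr rfl fun i _ => ?_
    rw [hreplace _ fun y c h => ?_, kconv_pderiv (hSc.of_le (by norm_num)) (hqc i) (hqs i)]
    · simp only [hq, mul_comm]
    · refine pderiv_eq_zero_of_eventuallyEq (c := 0) ?_ i
      filter_upwards [pderiv_eventuallyEq_zero h i] with w hw
      simp [hq, hw]
  · refine hreplace _ fun y c h => ?_
    have : lap χ y = 0 := Finset.sum_eq_zero fun i _ =>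
      pderiv_eq_zero_of_eventuallyEq (pderiv_eventuallyEq_zero h i) i
    simp [this]

/-! ### Regularity and the equation for a uniform limit -/

lemma tendsto_kconv_mul {K φ q : E → ℝ} {q' : ℕ → E → ℝ} (hK : LocallyIntegrable K)
    (hφ : Continuous φ) (hφs : HasCompactSupport φ) (hq : Continuous q)
    (hq' : ∀ k, Continuous (q' k)) {δ : ℕ → ℝ} (hδ : Tendsto δ atTop (𝓝 0))
    (h : ∀ k y, |q' k y - q y| ≤ δ k) (x : E) :
    Tendsto (fun k => kconv K (fun y => φ y * q' k y) x) atTop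
      (𝓝 (kconv K (fun y => φ y * q y) x)) := by
  obtain ⟨r, hr⟩ := exists_radius_of_hasCompactSupport hφs
  obtain ⟨C, hC⟩ := hφs.exists_bound_of_continuous hφ
  have hδC : Tendsto (fun k => C * δ k) atTop (𝓝 0) := by simpa using hδ.const_mul C
  refine tendsto_kconv hK (hφ.mul hq) (fun k => hφ.mul (hq' k)) (r := r)
    (fun y hy => by simp [hr y hy]) (fun k y hy => by simp [hr y hy]) hδC (fun k y => ?_) x
  change |φ y * q' k y - φ y * q y| ≤ _
  rw [← mul_sub, abs_mul]
  exact mul_le_mul (hC y) (h k y) (abs_nonneg _) ((norm_nonneg _).trans (hC y))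

/-- A uniform limit `z` of functions `ζ k` with `Δ (ζ k) = V (h k - 1)` and `h k → z`
is of class `C²`. -/
lemma contDiff_two_of_approximate_solutions (hn : 3 ≤ n) {V z : E → ℝ} {ζ h : ℕ → E → ℝ}
    {δ : ℕ → ℝ} (hV : ContDiff ℝ 2 V) (hz : Continuous z) (hζ : ∀ k, ContDiff ℝ 2 (ζ k))
    (hh : ∀ k, Continuous (h k)) (hδ : Tendsto δ atTop (𝓝 0)) (hhz : ∀ k x, |h k x - z x| ≤ δ k)
    (hζz : ∀ k x, |ζ k x - z x| ≤ δ k) (hlap : ∀ k x, lap (ζ k) x = V x * (h k x - 1)) :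
    ContDiff ℝ 2 z := by
  have hc := newtonConst_pos hn
  have hG : LocallyIntegrable (radPow 0 (newtonExp n) : E → ℝ) := locallyIntegrable_newton hn
  have key (R : ℝ) (hR : 0 < R) : ∃ χ g : E → ℝ, ContDiff ℝ 2 χ ∧ HasCompactSupport χ ∧
      ContDiff ℝ 2 g ∧ ∀ x ∈ ball (0 : E) R, z x = -(newtonConst n)⁻¹ *
        (kconv (radPow 0 (newtonExp n)) (fun y => χ y * (z y - 1)) x + g x) := by
    obtain ⟨χ, S, hχ, hχs, hS, hSs, hrep⟩ := exists_localized_representation hn hR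
    have hχ2 : ContDiff ℝ 2 χ := hχ.of_le (by norm_num)
    have hSp (i : Fin n) : ContDiff ℝ 2 (pderiv i S) := hS.pderiv (by norm_num) i
    have hχp (i : Fin n) : Continuous (pderiv i χ) :=
      (hχ.pderiv (m := 2) (by norm_num) i).continuous
    have hχV : ContDiff ℝ 2 fun y => χ y * V y := hχ2.mul hV
    refine ⟨fun y => χ y * V y, fun x => 2 * ∑ i, kconv (pderiv i S) (fun y => pderiv i χ y * z y) x
      - kconv S (fun y => lap χ y * z y) x, hχV, hχs.mul_right, ?_, fun x hx => ?_⟩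
    · refine (contDiff_const.mul (ContDiff.sum fun i _ => ?_)).sub ?_
      · exact contDiff_kconv_left (m := 2) (hSp i) (hSs.pderiv i) ((hχp i).mul hz)
      · exact contDiff_kconv_left (m := 2) (hS.of_le (by norm_num)) hSs
          (hχ2.continuous_lap.mul hz)
    · have hζx : Tendsto (fun k => ζ k x) atTop (𝓝 (z x)) :=
        tendsto_iff_norm_sub_tendsto_zero.2 (squeeze_zero (fun _ => norm_nonneg _)
          (fun k => hζz k x) hδ)
      have h1 := tendsto_kconv_mul hG hχV.continuous hχs.mul_right
        (hz.sub continuous_const) (q' := fun k y => h k y - 1) (q := fun y => z y - 1)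
        (fun k => (hh k).sub continuous_const) hδ (fun k y => by simpa using hhz k y) x
      have h2 (i : Fin n) := tendsto_kconv_mul (hSp i).continuous.locallyIntegrable (hχp i)
        (hχs.pderiv i) hz (fun k => (hζ k).continuous) hδ hζz x
      have h3 := tendsto_kconv_mul hS.continuous.locallyIntegrable hχ2.continuous_lap
        hχs.lap hz (fun k => (hζ k).continuous) hδ hζz x
      have hlim := (h1.add ((tendsto_finsetSum Finset.univ fun i _ => h2 i).const_mul 2)).sub h3
      have heq := tendsto_nhds_unique ((hζx.const_mul (-newtonConst n)).congr fun k => ?_) hlim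
      · rw [add_sub_assoc] at heq
        rw [← heq]
        field_simp
      · rw [hrep (ζ k) (hζ k) x hx]
        simp only [hlap, mul_assoc]
  have upgrade {m : WithTop ℕ∞} (hm : m ≤ 2) (H : ∀ χ : E → ℝ, ContDiff ℝ 2 χ →
      HasCompactSupport χ →
      ContDiff ℝ m (kconv (radPow 0 (newtonExp n)) (fun y => χ y * (z y - 1)))) :
      ContDiff ℝ m z := by
    refine contDiff_iff_contDiffAt.2 fun x => ?_
    obtain ⟨χ, g, hχ, hχs, hg, hrep⟩ := key (‖x‖ + 1) (by positivity)
    refine ContDiffAt.congr_of_eventuallyEq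
      (contDiff_const.mul ((H χ hχ hχs).add (hg.of_le hm))).contDiffAt
      (eventually_of_mem (isOpen_ball.mem_nhds ?_) hrep)
    simp
  have h1 : ContDiff ℝ 1 z := upgrade (by norm_num) fun χ hχ hχs =>
    contDiff_one_kconv_newton hn (hχ.continuous.mul (hz.sub continuous_const)) hχs.mul_right
  exact upgrade le_rfl fun χ hχ hχs => contDiff_two_kconv_newton hn
    ((hχ.of_le (by norm_num)).mul (h1.sub contDiff_const)) hχs.mul_right

lemma lap_eq_of_approximate_solutions {V z : E → ℝ} {ζ h : ℕ → E → ℝ}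
    {δ : ℕ → ℝ} (hV : Continuous V) (hz : ContDiff ℝ 2 z) (hζ : ∀ k, ContDiff ℝ 2 (ζ k))
    (hh : ∀ k, Continuous (h k)) (hδ : Tendsto δ atTop (𝓝 0)) (hhz : ∀ k x, |h k x - z x| ≤ δ k)
    (hζz : ∀ k x, |ζ k x - z x| ≤ δ k) (hlap : ∀ k x, lap (ζ k) x = V x * (h k x - 1)) (x : E) :
    lap z x = V x * (z x - 1) := by
  have hone : LocallyIntegrable (fun _ : E => (1 : ℝ)) := continuous_const.locallyIntegrable
  have hflip (F q : E → ℝ) :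
      kconv F q 0 = kconv (fun _ => 1) (fun y => q y * F (-y)) 0 := by
    simp [kconv, mul_comm]
  have hweak (q : E → ℝ) (hq : ContDiff ℝ 2 q) (hqs : HasCompactSupport q) :
      kconv (lap z) q 0 = kconv (fun y => V y * (z y - 1)) q 0 := by
    have h1 := tendsto_kconv_mul hone hq.continuous_lap hqs.lap (q := fun y => z (-y))
      (q' := fun k y => ζ k (-y)) (hz.continuous.comp continuous_neg)
      (fun k => (hζ k).continuous.comp continuous_neg) hδ (fun k y => hζz k (-y)) 0
    have h2 := tendsto_kconv_mul hone (φ := fun y => q y * V (-y)) (by fun_prop) hqs.mul_right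
      (q := fun y => z (-y) - 1) (q' := fun k y => h k (-y) - 1) (by fun_prop)
      (fun k => by fun_prop) hδ (fun k y => by simpa using hhz k (-y)) 0
    rw [← kconv_lap hz hq hqs, hflip z, hflip fun y => V y * (z y - 1)]
    simp only [mul_assoc] at h2
    refine tendsto_nhds_unique h1 (h2.congr fun k => ?_)
    rw [← hflip (ζ k) (lap q), kconv_lap (hζ k) hq hqs, hflip (lap (ζ k))]
    simp only [hlap]
  have hf : Continuous fun x => lap z x - V x * (z x - 1) := by
    have := hz.continuous_lap
    fun_prop
  have hae := ae_eq_zero_of_integral_contDiff_smul_eq_zero (μ := volume) hf.locallyIntegrable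
    fun g hg hgs => by
      have hg2 : ContDiff ℝ 2 fun y => g (-y) := (contDiff_infty.1 hg 2).comp contDiff_neg
      have hgs' : HasCompactSupport fun y => g (-y) := by
        simpa using hgs.comp_sub_left' 0
      have hw := hweak _ hg2 hgs'
      have hi1 := integrable_kconv hz.continuous_lap.locallyIntegrable hg2.continuous hgs' 0
      have hi2 := integrable_kconv (K := fun y => V y * (z y - 1))
        (Continuous.locallyIntegrable (by fun_prop)) hg2.continuous hgs' 0
      rw [kconv, kconv, ← sub_eq_zero, ← integral_sub hi1 hi2] at hw
      rw [← hw]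
      congr 1 with t
      simp
      ring
  have := congrFun ((hf.ae_eq_iff_eq volume continuous_const).1 hae) x
  linarith

/-! ### Barriers -/

/-- If `V ≥ 0` has a positive decaying potential `u`, then `Δ z = V (z - 1)` has a `C²` solution
with values in `(0, 1)` that tends to `0` at infinity. -/
lemma exists_solution_of_potential (hn : 3 ≤ n) {V u : E → ℝ} (hV : ContDiff ℝ 2 V)
    (hV0 : ∀ x, 0 ≤ V x) (hu : ContDiff ℝ 2 u) (hupos : ∀ x, 0 < u x)
    (hulap : ∀ x, lap u x = -V x) (hulim : Tendsto u (cocompact E) (𝓝 0)) :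
    ∃ z : E → ℝ, ContDiff ℝ 2 z ∧ (∀ x, 0 < z x ∧ z x < 1) ∧
      (∀ x, lap z x = V x * (z x - 1)) ∧ Tendsto z (cocompact E) (𝓝 0) := by
  obtain ⟨z, h, δ, hzc, hzlim, hh, hhs, hδ, hhz, hζz⟩ :=
    exists_approximate_solutions hn hV hV0 hu hupos hulap hulim
  have hP (k : ℕ) : ContDiff ℝ 2 (poisson fun y => V y * h k y) :=
    contDiff_poisson hn (hV.mul (hh k)) (hhs k).mul_left
  have hζ (k : ℕ) : ContDiff ℝ 2 fun x => u x - poisson (fun y => V y * h k y) x :=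
    hu.sub (hP k)
  have hζlap (k : ℕ) (x : E) :
      lap (fun x => u x - poisson (fun y => V y * h k y) x) x = V x * (h k x - 1) := by
    rw [lap_sub hu (hP k), hulap, lap_poisson hn (hV.mul (hh k)) (hhs k).mul_left]
    ring
  have hz := contDiff_two_of_approximate_solutions hn hV hzc hζ (fun k => (hh k).continuous) hδ
    hhz hζz hζlap
  have hzlap := lap_eq_of_approximate_solutions hV.continuous hz hζ (fun k => (hh k).continuous) hδ
    hhz hζz hζlap
  refine ⟨z, hz, fun x => ⟨?_, ?_⟩, hzlap, hzlim⟩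
  · obtain ⟨M, hM⟩ : ∃ M, ∀ y, u y ≤ M := by
      let U : ZeroAtInftyContinuousMap E ℝ := ⟨⟨u, hu.continuous⟩, hulim⟩
      exact ⟨‖U‖, fun y => (le_abs_self _).trans (U.abs_apply_le y)⟩
    have hM0 : 0 < 1 + M := by linarith [hupos x, hM x]
    have hεu : ContDiff ℝ 2 fun y => (1 + M)⁻¹ * u y := contDiff_const.mul hu
    have := nonneg_of_lap_nonpos hn (f := fun y => z y - (1 + M)⁻¹ * u y) (hz.sub hεu)
      (by simpa using hzlim.sub (hulim.const_mul (1 + M)⁻¹)) (fun y hy => ?_) x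
    · have := mul_pos (inv_pos.2 hM0) (hupos x)
      linarith
    · rw [lap_sub hz hεu, lap_const_mul hu, hzlap, hulap]
      have h1 : (1 + M)⁻¹ * u y ≤ (1 + M)⁻¹ * M :=
        mul_le_mul_of_nonneg_left (hM y) (inv_pos.2 hM0).le
      have h2 : (1 + M)⁻¹ * (1 + M) = 1 := inv_mul_cancel₀ hM0.ne'
      have h3 : z y - 1 + (1 + M)⁻¹ ≤ 0 := by linarith
      nlinarith [mul_nonneg (hV0 y) (neg_nonneg.2 h3)]
  · have hE : ContDiff ℝ 2 fun y => Real.exp (-u y) := hu.neg.exp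
    have hE' : ContDiff ℝ 2 fun y => Real.exp (-u y) + z y := hE.add hz
    have := nonneg_of_lap_nonpos hn (f := fun y => 1 - (Real.exp (-u y) + z y))
      (contDiff_const.sub hE') ?_ (fun y hy => ?_) x
    · have := Real.exp_pos (-u x)
      linarith
    · have := (((Real.continuous_exp.tendsto _).comp hulim.neg).add hzlim).const_sub 1
      simpa using this
    · rw [lap_sub contDiff_const hE', lap_const, lap_add hE hz, lap_exp_neg hu, hzlap, hulap]
      have h1 : 0 ≤ Real.exp (-u y) * ∑ i, pderiv i u y ^ 2 :=
        mul_nonneg (Real.exp_pos _).le (Finset.sum_nonneg fun i _ => sq_nonneg _)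
      nlinarith [mul_nonneg (hV0 y) (neg_nonneg.2 hy.le)]

end YamabeHelpers

/-- Existence of a Yamabe conformal factor with zero scalar curvature: if `-c_n Δu = R₀`
has a positive decaying solution, then there is a `C²` function `w` with `0 < w < 1`
solving `-c_n Δw + R₀ w = 0` and `w → 1` at infinity. -/
theorem yamabe_zero_scalar_factor (n : ℕ) (hn : 3 ≤ n)
    (R₀ : EuclideanSpace ℝ (Fin n) → ℝ) (hR₀s : ContDiff ℝ (⊤ : ℕ∞) R₀) (hR₀ : ∀ x, 0 ≤ R₀ x)
    (u : EuclideanSpace ℝ (Fin n) → ℝ) (hu : ContDiff ℝ 2 u) (hupos : ∀ x, 0 < u x)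
    (hueq : ∀ x, -(4 * ((n : ℝ) - 1) / ((n : ℝ) - 2)) * lap u x = R₀ x)
    (hulim : Tendsto u (cocompact (EuclideanSpace ℝ (Fin n))) (nhds 0)) :
    ∃ w : EuclideanSpace ℝ (Fin n) → ℝ, ContDiff ℝ 2 w ∧
      (∀ x, 0 < w x ∧ w x < 1) ∧
      (∀ x, -(4 * ((n : ℝ) - 1) / ((n : ℝ) - 2)) * lap w x + R₀ x * w x = 0) ∧
      Tendsto w (cocompact (EuclideanSpace ℝ (Fin n))) (nhds 1) := by
  have hn' : (3 : ℝ) ≤ n := by exact_mod_cast hn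
  have hc : 0 < 4 * ((n : ℝ) - 1) / ((n : ℝ) - 2) :=
    div_pos (by linarith) (by linarith)
  set c := 4 * ((n : ℝ) - 1) / ((n : ℝ) - 2)
  obtain ⟨z, hz, hz01, hzlap, hzlim⟩ := exists_solution_of_potential hn (V := fun x => R₀ x / c)
    ((contDiff_infty.1 hR₀s 2).div_const c) (fun x => div_nonneg (hR₀ x) hc.le) hu hupos
    (fun x => by rw [← hueq x]; field_simp) hulim
  refine ⟨fun x => 1 - z x, contDiff_const.sub hz,
    fun x => ⟨by linarith [(hz01 x).2], by linarith [(hz01 x).1]⟩, fun x => ?_,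
    by simpa using hzlim.const_sub 1⟩
  rw [lap_sub contDiff_const hz, lap_const, hzlap]
  field_simp
  ring
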